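/- For every n ≥ 3 there exists an open set E ⊆ ℝⁿ that is both weakly 1-convex and weakly 1-semiconvex, such that E^△ = E^◇ ≠ ∅ and this set is bounded, connected, and not convex. -/

import Mathlib

open Set Metric

/-- The closed ray with endpoint `x` in direction `α`. -/
def ray {n : ℕ} (x α : EuclideanSpace ℝ (Fin n)) : Set (EuclideanSpace ℝ (Fin n)) :=
  {z | ∃ t : ℝ, 0 ≤ t ∧ z = x + t • α}

/-- The straight line through `x` in direction `α`. -/
def line {n : ℕ} (x α : EuclideanSpace ℝ (Fin n)) : Set (EuclideanSpace ℝ (Fin n)) :=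
  {z | ∃ t : ℝ, z = x + t • α}

/-- The set `E^◇` of 1-nonsemiconvexity points of `E`. -/
def diamond {n : ℕ} (E : Set (EuclideanSpace ℝ (Fin n))) : Set (EuclideanSpace ℝ (Fin n)) :=
  {x | x ∉ E ∧ ∀ α : EuclideanSpace ℝ (Fin n), ‖α‖ = 1 → (ray x α ∩ E).Nonempty}

/-- The set `E^△` of 1-nonconvexity points of `E`. -/
def triangle {n : ℕ} (E : Set (EuclideanSpace ℝ (Fin n))) : Set (EuclideanSpace ℝ (Fin n)) :=
  {x | x ∉ E ∧ ∀ α : EuclideanSpace ℝ (Fin n), ‖α‖ = 1 → (line x α ∩ E).Nonempty}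

/-- An (open) set is weakly 1-semiconvex if through every boundary point
there passes a closed ray missing the set. -/
def WeaklySemiconvex {n : ℕ} (E : Set (EuclideanSpace ℝ (Fin n))) : Prop :=
  ∀ x ∈ frontier E, ∃ α : EuclideanSpace ℝ (Fin n), ‖α‖ = 1 ∧ ray x α ∩ E = ∅

/-- An (open) set is weakly 1-convex if through every boundary point
there passes a straight line missing the set. -/
def WeaklyConvex {n : ℕ} (E : Set (EuclideanSpace ℝ (Fin n))) : Prop :=
  ∀ x ∈ frontier E, ∃ α : EuclideanSpace ℝ (Fin n), ‖α‖ = 1 ∧ line x α ∩ E = ∅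

namespace HypExample

open Filter

abbrev V (m : ℕ) := EuclideanSpace ℝ (Fin (m + 3))

/-- The quadratic form cutting out the hyperboloid of one sheet. -/
def q {m : ℕ} (x : V m) : ℝ := x 0 ^ 2 + x 1 ^ 2 - x 2 ^ 2 - 1

/-- The complement of the union of hyperplanes and the hyperboloid. -/
def G (m : ℕ) : Set (V m) :=
  {x | q x ≠ 0 ∧ ∀ i, i ≠ 0 → i ≠ 1 → x i ^ 2 - 1 ≠ 0}

/-- The bounded component of `G`. -/
def U (m : ℕ) : Set (V m) :=
  {x | q x < 0 ∧ ∀ i, i ≠ 0 → i ≠ 1 → x i ^ 2 - 1 < 0}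

/-- The example: all the other components of `G`. -/
def E (m : ℕ) : Set (V m) :=
  G m ∩ {x | 0 < q x ∨ ∃ i, i ≠ 0 ∧ i ≠ 1 ∧ 0 < x i ^ 2 - 1}

lemma ne10 {m : ℕ} : (1 : Fin (m + 3)) ≠ 0 := by simp [Fin.ext_iff]
lemma ne20 {m : ℕ} : (2 : Fin (m + 3)) ≠ 0 := by
  intro h
  have h' := congrArg Fin.val h
  have e : ((2 : Fin (m + 3)) : ℕ) = 2 :=
    Nat.mod_eq_of_lt (show 2 < m + 3 by omega)
  rw [e] at h'
  simp at h'
lemma ne21 {m : ℕ} : (2 : Fin (m + 3)) ≠ 1 := by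
  intro h
  have h' := congrArg Fin.val h
  have e : ((2 : Fin (m + 3)) : ℕ) = 2 :=
    Nat.mod_eq_of_lt (show 2 < m + 3 by omega)
  rw [e] at h'
  simp at h'

lemma cont_q {m : ℕ} : Continuous (q : V m → ℝ) := by unfold q; fun_prop

lemma isOpen_G (m : ℕ) : IsOpen (G m) := by
  have : G m = {x | q x ≠ 0} ∩ ⋂ i, {x | i ≠ 0 → i ≠ 1 → x i ^ 2 - 1 ≠ 0} := by
    ext x; simp [G]
  rw [this]
  refine (isOpen_ne_fun cont_q continuous_const).inter (isOpen_iInter_of_finite fun i => ?_)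
  by_cases h0 : i = 0
  · simp [h0]
  by_cases h1 : i = 1
  · simp [h1]
  simp only [h0, h1, ne_eq, not_false_eq_true, forall_const]
  exact isOpen_ne_fun (by fun_prop) continuous_const

lemma isOpen_U (m : ℕ) : IsOpen (U m) := by
  have : U m = {x | q x < 0} ∩ ⋂ i, {x | i ≠ 0 → i ≠ 1 → x i ^ 2 - 1 < 0} := by
    ext x; simp [U]
  rw [this]
  refine (isOpen_lt cont_q continuous_const).inter (isOpen_iInter_of_finite fun i => ?_)
  by_cases h0 : i = 0
  · simp [h0]
  by_cases h1 : i = 1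
  · simp [h1]
  simp only [h0, h1, ne_eq, not_false_eq_true, forall_const]
  exact isOpen_lt (by fun_prop) continuous_const

lemma isOpen_E (m : ℕ) : IsOpen (E m) := by
  refine (isOpen_G m).inter ?_
  have : {x : V m | 0 < q x ∨ ∃ i, i ≠ 0 ∧ i ≠ 1 ∧ 0 < x i ^ 2 - 1}
      = {x | 0 < q x} ∪ ⋃ i, {x | i ≠ 0 ∧ i ≠ 1 ∧ 0 < x i ^ 2 - 1} := by
    ext x; simp
  rw [this]
  refine (isOpen_lt continuous_const cont_q).union (isOpen_iUnion fun i => ?_)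
  by_cases h0 : i = 0
  · simp [h0]
  by_cases h1 : i = 1
  · simp [h1]
  simp only [h0, h1, ne_eq, not_false_eq_true, true_and]
  exact isOpen_lt continuous_const (by fun_prop)

lemma E_subset_G (m : ℕ) : E m ⊆ G m := inter_subset_left

lemma disj {m : ℕ} {x : V m} (h : x ∈ U m) : x ∉ E m := by
  rintro ⟨-, h1 | ⟨i, h0, h1, h2⟩⟩
  · exact lt_asymm h1 h.1
  · exact lt_asymm h2 (h.2 i h0 h1)

lemma cover {m : ℕ} {x : V m} (hG : x ∈ G m) (hE : x ∉ E m) : x ∈ U m := by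
  have h : ¬ (0 < q x ∨ ∃ i, i ≠ 0 ∧ i ≠ 1 ∧ 0 < x i ^ 2 - 1) := fun h => hE ⟨hG, h⟩
  push Not at h
  exact ⟨lt_of_le_of_ne h.1 hG.1, fun i h0 h1 => lt_of_le_of_ne (h.2 i h0 h1) (hG.2 i h0 h1)⟩

/-- Normalising a direction. -/
lemma normalise {m : ℕ} {x v : V m} (hv : v ≠ 0) (h : ∀ t : ℝ, x + t • v ∉ G m) :
    ∃ α : V m, ‖α‖ = 1 ∧ line x α ∩ G m = ∅ := by
  refine ⟨‖v‖⁻¹ • v, ?_, ?_⟩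
  · rw [norm_smul, norm_inv, norm_norm, inv_mul_cancel₀ (norm_ne_zero_iff.2 hv)]
  · rw [eq_empty_iff_forall_notMem]
    rintro _ ⟨⟨t, rfl⟩, hz⟩
    rw [smul_smul] at hz
    exact h _ hz

lemma exists_line {m : ℕ} {x : V m} (hx : x ∉ G m) :
    ∃ α : V m, ‖α‖ = 1 ∧ line x α ∩ G m = ∅ := by
  by_cases hq : q x = 0
  · let v : V m := WithLp.toLp 2 fun i => if i = 0 then x 0 * x 2 - x 1 else
      if i = 1 then x 1 * x 2 + x 0 else if i = 2 then 1 + x 2 ^ 2 else 0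
    have v0 : v 0 = x 0 * x 2 - x 1 := by simp [v]
    have v1 : v 1 = x 1 * x 2 + x 0 := by simp [v]
    have v2 : v 2 = 1 + x 2 ^ 2 := by simp [v, ne20, ne21]
    refine normalise (v := v) ?_ ?_
    · intro h
      have : v 2 = 0 := by rw [h]; rfl
      rw [v2] at this
      nlinarith [sq_nonneg (x 2)]
    · intro t h
      apply h.1
      simp only [q, PiLp.add_apply, PiLp.smul_apply, smul_eq_mul, v0, v1, v2] at hq ⊢
      have e : x 0 ^ 2 = 1 + x 2 ^ 2 - x 1 ^ 2 := by linarith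
      linear_combination (1 + 2 * t * x 2 + t ^ 2 * (1 + x 2 ^ 2)) * hq
  · have : ∃ i, i ≠ 0 ∧ i ≠ 1 ∧ x i ^ 2 - 1 = 0 := by
      by_contra hc
      push Not at hc
      exact hx ⟨hq, hc⟩
    obtain ⟨i, h0, h1, h2⟩ := this
    refine normalise (v := EuclideanSpace.single 0 1) (by simp) ?_
    intro t h
    apply h.2 i h0 h1
    simpa [h0] using h2

lemma ev_ne {a b c : ℝ} (ha : a ≠ 0) : ∀ᶠ t : ℝ in atTop, a + b * t + c * t ^ 2 ≠ 0 := by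
  let P : Polynomial ℝ := Polynomial.C a + Polynomial.C b * Polynomial.X
    + Polynomial.C c * Polynomial.X ^ 2
  have hP : P ≠ 0 := by
    intro h
    have := congrArg (Polynomial.eval 0) h
    simp [P] at this
    exact ha this
  filter_upwards [Polynomial.eventually_atTop_not_isRoot P hP] with t ht h
  apply ht
  simpa [P, Polynomial.IsRoot] using h

lemma ev_pos {a b c : ℝ} (hc : 0 < c) : ∀ᶠ t : ℝ in atTop, 0 < a + b * t + c * t ^ 2 := by
  filter_upwards [eventually_gt_atTop ((|a| + |b|) / c + 1)] with t ht
  have h0 : 0 ≤ (|a| + |b|) / c := by positivity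
  have h1 : 1 < t := by linarith
  have h2 : |a| + |b| < c * t := by
    have : (|a| + |b|) / c < t := by linarith
    rw [div_lt_iff₀ hc] at this
    linarith
  have h3 : (|a| + |b|) * t < c * t ^ 2 := by nlinarith
  have h4 : |a| ≤ |a| * t := by nlinarith [abs_nonneg a]
  have h5 : -(|b| * t) ≤ b * t := by nlinarith [neg_abs_le b]
  nlinarith [neg_abs_le a]

lemma ray_hits {m : ℕ} {x : V m} (hx : x ∈ U m) {α : V m} (hα : ‖α‖ = 1) :
    (ray x α ∩ E m).Nonempty := by
  have eq1 : ∀ t : ℝ, q (x + t • α) = q x + 2 * (x 0 * α 0 + x 1 * α 1 - x 2 * α 2) * t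
      + (α 0 ^ 2 + α 1 ^ 2 - α 2 ^ 2) * t ^ 2 := by
    intro t; simp [q]; ring
  have eq2 : ∀ (i) (t : ℝ), (x + t • α) i ^ 2 - 1 = (x i ^ 2 - 1) + (2 * x i * α i) * t
      + α i ^ 2 * t ^ 2 := by
    intro i t; simp; ring
  have hG : ∀ᶠ t : ℝ in atTop, x + t • α ∈ G m := by
    have h1 : ∀ᶠ t : ℝ in atTop, q (x + t • α) ≠ 0 := by
      simp only [eq1]; exact ev_ne hx.1.ne
    have h2 : ∀ᶠ t : ℝ in atTop, ∀ i, i ≠ 0 → i ≠ 1 → (x + t • α) i ^ 2 - 1 ≠ 0 := by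
      rw [eventually_all]
      intro i
      by_cases h0 : i = 0
      · simp [h0]
      by_cases h1 : i = 1
      · simp [h1]
      simp only [eq2]
      filter_upwards [ev_ne (b := 2 * x i * α i) (c := α i ^ 2) (hx.2 i h0 h1).ne] with t ht _ _
      exact ht
    filter_upwards [h1, h2] with t h1 h2 using ⟨h1, h2⟩
  have hpos : ∀ᶠ t : ℝ in atTop, 0 < q (x + t • α) ∨
      ∃ i, i ≠ 0 ∧ i ≠ 1 ∧ 0 < (x + t • α) i ^ 2 - 1 := by
    by_cases h : ∃ i, i ≠ 0 ∧ i ≠ 1 ∧ α i ≠ 0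
    · obtain ⟨i, h0, h1, h2⟩ := h
      filter_upwards [ev_pos (a := x i ^ 2 - 1) (b := 2 * x i * α i) (pow_pos (abs_pos.2 h2) 2)]
        with t ht
      refine Or.inr ⟨i, h0, h1, ?_⟩
      rw [eq2]
      rwa [sq_abs] at ht
    · push Not at h
      have h2 := h 2 ne20 ne21
      have h3 : 0 < α 0 ^ 2 + α 1 ^ 2 - α 2 ^ 2 := by
        by_contra hc
        rw [h2] at hc
        have a0 : α 0 = 0 := by nlinarith [sq_nonneg (α 0), sq_nonneg (α 1)]
        have a1 : α 1 = 0 := by nlinarith [sq_nonneg (α 0), sq_nonneg (α 1)]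
        have : α = 0 := by
          ext i
          by_cases h0 : i = 0
          · rw [h0, a0]; rfl
          by_cases h1 : i = 1
          · rw [h1, a1]; rfl
          exact h i h0 h1
        rw [this] at hα
        simp at hα
      filter_upwards [ev_pos (a := q x) (b := 2 * (x 0 * α 0 + x 1 * α 1 - x 2 * α 2)) h3]
        with t ht
      left
      rw [eq1]
      exact ht
  obtain ⟨t, ⟨h1, h2⟩, h3⟩ := ((hG.and hpos).and (eventually_ge_atTop 0)).exists
  exact ⟨x + t • α, ⟨t, h3, rfl⟩, h1, h2⟩

lemma ray_subset_line {n : ℕ} (x α : EuclideanSpace ℝ (Fin n)) : ray x α ⊆ line x α := by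
  rintro _ ⟨t, -, rfl⟩
  exact ⟨t, rfl⟩

lemma diamond_subset {n : ℕ} (A : Set (EuclideanSpace ℝ (Fin n))) : diamond A ⊆ triangle A :=
  fun x hx => ⟨hx.1, fun α hα => (hx.2 α hα).mono (inter_subset_inter_left _ (ray_subset_line x α))⟩

lemma U_subset (m : ℕ) : U m ⊆ diamond (E m) :=
  fun _ hx => ⟨disj hx, fun _ hα => ray_hits hx hα⟩

lemma triangle_eq (m : ℕ) : triangle (E m) = U m := by
  refine Subset.antisymm ?_ ((U_subset m).trans (diamond_subset _))
  rintro x ⟨hE, h⟩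
  refine cover ?_ hE
  by_contra hG
  obtain ⟨α, hα, h'⟩ := exists_line hG
  have := (h α hα).mono (inter_subset_inter_right _ (E_subset_G m))
  rw [h'] at this
  exact not_nonempty_empty this

lemma diamond_eq (m : ℕ) : diamond (E m) = U m :=
  Subset.antisymm ((diamond_subset _).trans (triangle_eq m).subset) (U_subset m)

lemma weaklyConvex (m : ℕ) : WeaklyConvex (E m) := by
  intro x hx
  have hE : x ∉ E m := by
    have := hx.2
    rwa [(isOpen_E m).interior_eq] at this
  have hG : x ∉ G m := by
    intro hG
    have hU := cover hG hE
    obtain ⟨y, hy, hy'⟩ := mem_closure_iff.1 hx.1 (U m) (isOpen_U m) hU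
    exact disj hy hy'
  obtain ⟨α, hα, h⟩ := exists_line hG
  exact ⟨α, hα, subset_empty_iff.1 (h ▸ inter_subset_inter_right _ (E_subset_G m))⟩

lemma weaklySemiconvex (m : ℕ) : WeaklySemiconvex (E m) := by
  intro x hx
  obtain ⟨α, hα, h⟩ := weaklyConvex m x hx
  exact ⟨α, hα, subset_empty_iff.1 (h ▸ inter_subset_inter_left _ (ray_subset_line x α))⟩

lemma zero_mem (m : ℕ) : (0 : V m) ∈ U m := by simp [U, q]

lemma starConvex (m : ℕ) : StarConvex ℝ (0 : V m) (U m) := by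
  rw [starConvex_zero_iff]
  intro x hx t ht0 ht1
  have ht : t ^ 2 ≤ 1 := by nlinarith
  have ht' : 0 ≤ t ^ 2 := sq_nonneg t
  refine ⟨?_, fun i h0 h1 => ?_⟩
  · have := hx.1
    simp only [q, PiLp.smul_apply, smul_eq_mul] at this ⊢
    by_cases h : t ^ 2 = 0
    · simp only [mul_pow, h]; norm_num
    · have : 0 < t ^ 2 := lt_of_le_of_ne ht' (Ne.symm h)
      nlinarith
  · have := hx.2 i h0 h1
    simp only [PiLp.smul_apply, smul_eq_mul]
    nlinarith [sq_nonneg (x i)]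

lemma isConnected_U (m : ℕ) : IsConnected (U m) :=
  ((starConvex m).isPathConnected (zero_mem m)).isConnected

lemma bounded_U (m : ℕ) : Bornology.IsBounded (U m) := by
  refine (Metric.isBounded_closedBall (x := (0 : V m)) (r := √(∑ _i : Fin (m + 3), 2))).subset ?_
  intro x hx
  rw [mem_closedBall_zero_iff, EuclideanSpace.norm_eq]
  refine Real.sqrt_le_sqrt (Finset.sum_le_sum fun i _ => ?_)
  rw [Real.norm_eq_abs, sq_abs]
  have h2 := hx.2 2 ne20 ne21
  have hq := hx.1
  simp only [q] at hq
  by_cases h0 : i = 0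
  · rw [h0]; nlinarith [sq_nonneg (x 1)]
  by_cases h1 : i = 1
  · rw [h1]; nlinarith [sq_nonneg (x 0)]
  linarith [hx.2 i h0 h1]

/-- Witness points for nonconvexity. -/
noncomputable def pt (m : ℕ) (s : ℝ) : V m :=
  WithLp.toLp 2 fun i => if i = 0 then 6 / 5 else if i = 2 then s else 0

lemma pt0 (m : ℕ) (s : ℝ) : pt m s 0 = 6 / 5 := by simp [pt]
lemma pt1 (m : ℕ) (s : ℝ) : pt m s 1 = 0 := by simp [pt, ne10, ne21.symm]
lemma pt2 (m : ℕ) (s : ℝ) : pt m s 2 = s := by simp [pt, ne20]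

lemma pt_mem (m : ℕ) (s : ℝ) (hs : s ^ 2 = 81 / 100) : pt m s ∈ U m := by
  refine ⟨?_, fun i h0 _ => ?_⟩
  · simp only [q, pt0, pt1, pt2, hs]; norm_num
  · by_cases h2 : i = 2
    · rw [h2, pt2, hs]; norm_num
    · simp [pt, h0, h2]

lemma not_convex_U (m : ℕ) : ¬ Convex ℝ (U m) := by
  intro h
  have := h (pt_mem m (9 / 10) (by norm_num)) (pt_mem m (-(9 / 10)) (by norm_num))
    (a := 1 / 2) (b := 1 / 2) (by norm_num) (by norm_num) (by norm_num)
  have := this.1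
  simp only [q, PiLp.add_apply, PiLp.smul_apply, smul_eq_mul, pt0, pt1, pt2] at this
  norm_num at this

end HypExample

theorem exists_bounded_nonconvex_example_dim {n : ℕ} (hn : 3 ≤ n) :
    ∃ E : Set (EuclideanSpace ℝ (Fin n)), IsOpen E ∧ WeaklyConvex E ∧ WeaklySemiconvex E ∧
      triangle E = diamond E ∧ (triangle E).Nonempty ∧
      Bornology.IsBounded (triangle E) ∧ IsConnected (triangle E) ∧
      ¬ Convex ℝ (triangle E) := by
  obtain ⟨m, rfl⟩ := Nat.exists_eq_add_of_le' hn
  refine ⟨HypExample.E m, HypExample.isOpen_E m, HypExample.weaklyConvex m,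
    HypExample.weaklySemiconvex m, ?_⟩
  rw [HypExample.triangle_eq, HypExample.diamond_eq]
  exact ⟨rfl, ⟨0, HypExample.zero_mem m⟩, HypExample.bounded_U m, HypExample.isConnected_U m,
    HypExample.not_convex_U m⟩
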